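/- Let κ be a perfect kernel on X satisfying Frostman's maximum principle and the domination principle, let A ⊆ X satisfy cap_*(A) > 0 and E⁺(A) closed in (E⁺, d), let f := −U^ζ where ζ ∈ E⁺ and ζ(X) ≤ 1, and assume either cap_*(A) < ∞ or ζ^A(X) = 1, so that the solution λ_{A,f} exists. Set η_{A,f} := (1 − ζ^A(X))/cap_*(A). Then λ_{A,f} is the unique measure μ ∈ E⁺(A) satisfying U_f^μ = η_{A,f} n.e. on A. -/

import Mathlib

open MeasureTheory Topology Filter Set ENNReal

noncomputable section

namespace GaussVar

variable {X : Type*} [TopologicalSpace X] [MeasurableSpace X]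

/-- A (positive) Radon measure: a regular Borel measure. -/
def IsRadon (μ : Measure X) : Prop := μ.Regular

/-- The mutual energy `I(μ,ν) = ∬ κ(x,y) d(μ⊗ν)(x,y)`. -/
def mutualEnergy (κ : X → X → ℝ≥0∞) (μ ν : Measure X) : ℝ≥0∞ :=
  ∫⁻ p : X × X, κ p.1 p.2 ∂(μ.prod ν)

/-- The energy `I(μ) := I(μ,μ)`. -/
def energy (κ : X → X → ℝ≥0∞) (μ : Measure X) : ℝ≥0∞ := mutualEnergy κ μ μ

/-- Membership in the cone `E⁺` of Radon measures with finite energy. -/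
def memEplus (κ : X → X → ℝ≥0∞) (μ : Measure X) : Prop :=
  IsRadon μ ∧ energy κ μ < ⊤

/-- A kernel: symmetric and lower semicontinuous with values in `[0,∞]`. -/
def IsKernel (κ : X → X → ℝ≥0∞) : Prop :=
  (∀ x y, κ x y = κ y x) ∧ LowerSemicontinuous (fun p : X × X => κ p.1 p.2)

/-- The strong (energy) metric `d(μ,ν) := (I(μ)+I(ν)−2I(μ,ν))^{1/2}` on `E⁺`. -/
def strongDist (κ : X → X → ℝ≥0∞) (μ ν : Measure X) : ℝ :=
  Real.sqrt ((energy κ μ).toReal + (energy κ ν).toReal - 2 * (mutualEnergy κ μ ν).toReal)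

/-- The energy principle (strict positive definiteness). -/
def EnergyPrinciple (κ : X → X → ℝ≥0∞) : Prop :=
  ∀ μ ν : Measure X, memEplus κ μ → memEplus κ ν →
    2 * mutualEnergy κ μ ν ≤ energy κ μ + energy κ ν ∧
      (2 * mutualEnergy κ μ ν = energy κ μ + energy κ ν → μ = ν)

/-- Convergence of a sequence in the strong metric. -/
def StrongTendstoSeq (κ : X → X → ℝ≥0∞) (μ : ℕ → Measure X) (μ₀ : Measure X) : Prop :=
  Tendsto (fun n => strongDist κ (μ n) μ₀) atTop (𝓝 0)

/-- Vague convergence of a sequence of measures. -/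
def VagueTendstoSeq (μ : ℕ → Measure X) (μ₀ : Measure X) : Prop :=
  ∀ φ : X → ℝ, Continuous φ → HasCompactSupport φ →
    Tendsto (fun n => ∫ x, φ x ∂(μ n)) atTop (𝓝 (∫ x, φ x ∂μ₀))

/-- Cauchy sequence in the strong metric. -/
def StrongCauchySeq (κ : X → X → ℝ≥0∞) (μ : ℕ → Measure X) : Prop :=
  ∀ ε : ℝ, 0 < ε → ∃ N : ℕ, ∀ m ≥ N, ∀ n ≥ N, strongDist κ (μ m) (μ n) < ε

/-- A perfect kernel: satisfies the energy principle, `(E⁺,d)` is complete, and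
strong convergence implies vague convergence. -/
def IsPerfect (κ : X → X → ℝ≥0∞) : Prop :=
  EnergyPrinciple κ ∧
    (∀ μ : ℕ → Measure X, (∀ n, memEplus κ (μ n)) → StrongCauchySeq κ μ →
        ∃ μ₀ : Measure X, memEplus κ μ₀ ∧ StrongTendstoSeq κ μ μ₀) ∧
    (∀ (μ : ℕ → Measure X) (μ₀ : Measure X), (∀ n, memEplus κ (μ n)) → memEplus κ μ₀ →
        StrongTendstoSeq κ μ μ₀ → VagueTendstoSeq μ μ₀)

/-- `μ` is concentrated on `A`: the complement of `A` is locally `μ`-negligible. -/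
def Concentrated (μ : Measure X) (A : Set X) : Prop :=
  ∀ K : Set X, IsCompact K → μ (Aᶜ ∩ K) = 0

/-- Membership in `Ĕ⁺(A)`: finite-energy Radon measures concentrated on `A`
of unit total mass. -/
def memBreve (κ : X → X → ℝ≥0∞) (A : Set X) (μ : Measure X) : Prop :=
  memEplus κ μ ∧ Concentrated μ A ∧ μ Set.univ = 1

/-- `w(A) := inf { I(μ) : μ ∈ Ĕ⁺(A) }` (with `inf ∅ = ⊤`). -/
def wcap (κ : X → X → ℝ≥0∞) (A : Set X) : ℝ≥0∞ :=
  ⨅ (μ : Measure X) (_ : memBreve κ A μ), energy κ μ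

/-- The inner capacity `cap_*(A) := 1 / w(A)`. -/
def innerCap (κ : X → X → ℝ≥0∞) (A : Set X) : ℝ≥0∞ := (wcap κ A)⁻¹

/-- The outer capacity `cap^*(E) := inf { cap_*(D) : D open, E ⊆ D }`. -/
def outerCap (κ : X → X → ℝ≥0∞) (E : Set X) : ℝ≥0∞ :=
  ⨅ (D : Set X) (_ : IsOpen D ∧ E ⊆ D), innerCap κ D

/-- `P` holds nearly everywhere (n.e.) on `A`: the exceptional subset of `A`
has inner capacity zero. -/
def NearlyEverywhere (κ : X → X → ℝ≥0∞) (A : Set X) (P : X → Prop) : Prop :=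
  innerCap κ {x ∈ A | ¬ P x} = 0

/-- The potential `U^μ(x) := ∫ κ(x,y) dμ(y)`. -/
def potential (κ : X → X → ℝ≥0∞) (μ : Measure X) (x : X) : ℝ≥0∞ :=
  ∫⁻ y, κ x y ∂μ

/-- An external field: `f = ψ + U^{ϑ⁺} − U^{ϑ⁻}` where `ψ` is lower semicontinuous,
`(−∞,∞]`-valued, positive if `X` is noncompact, and `ϑ⁺, ϑ⁻ ∈ E⁺`. -/
def IsExternalField (κ : X → X → ℝ≥0∞) (f : X → EReal) : Prop :=
  ∃ (ψ : X → EReal) (ϑp ϑm : Measure X),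
    LowerSemicontinuous ψ ∧ (∀ x, ψ x ≠ ⊥) ∧ (¬ CompactSpace X → ∀ x, 0 ≤ ψ x) ∧
    memEplus κ ϑp ∧ memEplus κ ϑm ∧
    ∀ x, f x = ψ x + (potential κ ϑp x : EReal) - (potential κ ϑm x : EReal)

/-- `f` is `μ`-integrable (as an extended-real-valued function). -/
def FieldIntegrable (f : X → EReal) (μ : Measure X) : Prop :=
  Integrable (fun x => (f x).toReal) μ ∧ (∀ᵐ x ∂μ, f x ≠ ⊤ ∧ f x ≠ ⊥)

/-- `∫ f dμ` for an a.e.-finite integrable field. -/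
def fieldIntegral (f : X → EReal) (μ : Measure X) : ℝ := ∫ x, (f x).toReal ∂μ

/-- The Gauss functional `I_f(μ) := I(μ) + 2 ∫ f dμ`. -/
def gaussI (κ : X → X → ℝ≥0∞) (f : X → EReal) (μ : Measure X) : ℝ :=
  (energy κ μ).toReal + 2 * fieldIntegral f μ

/-- Membership in `Ĕ⁺_f(A)`. -/
def Admissible (κ : X → X → ℝ≥0∞) (A : Set X) (f : X → EReal) (μ : Measure X) : Prop :=
  memBreve κ A μ ∧ FieldIntegrable f μ

/-- `w_f(A) := inf { I_f(μ) : μ ∈ Ĕ⁺_f(A) }` (with `inf ∅ = ⊤`). -/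
def wf (κ : X → X → ℝ≥0∞) (A : Set X) (f : X → EReal) : EReal :=
  ⨅ (μ : Measure X) (_ : Admissible κ A f μ), ((gaussI κ f μ : ℝ) : EReal)

/-- `l` is a solution of the inner Gauss variational problem for `(A,f)`. -/
def IsSolution (κ : X → X → ℝ≥0∞) (A : Set X) (f : X → EReal) (l : Measure X) : Prop :=
  Admissible κ A f l ∧ ((gaussI κ f l : ℝ) : EReal) = wf κ A f

/-- The `f`-weighted potential `U_f^μ := U^μ + f`. -/
def wPotential (κ : X → X → ℝ≥0∞) (f : X → EReal) (μ : Measure X) (x : X) : EReal :=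
  (potential κ μ x : EReal) + f x

/-- `∫ U_f^μ dμ`, the weighted equilibrium constant of a solution. -/
def wConst (κ : X → X → ℝ≥0∞) (f : X → EReal) (μ : Measure X) : ℝ :=
  ∫ x, (wPotential κ f μ x).toReal ∂μ

/-- The cone `E⁺(A)` is closed in the strong metric. -/
def StrongClosedEplusOn (κ : X → X → ℝ≥0∞) (A : Set X) : Prop :=
  ∀ (μ : ℕ → Measure X) (μ₀ : Measure X),
    (∀ n, memEplus κ (μ n) ∧ Concentrated (μ n) A) →
    memEplus κ μ₀ → StrongTendstoSeq κ μ μ₀ → Concentrated μ₀ A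

/-- Frostman's (first) maximum principle. -/
def FrostmanMax (κ : X → X → ℝ≥0∞) : Prop :=
  ∀ μ : Measure X, memEplus κ μ →
    (∀ x : X, (∀ U : Set X, IsOpen U → x ∈ U → 0 < μ U) → potential κ μ x ≤ 1) →
    ∀ x : X, potential κ μ x ≤ 1

/-- The domination (second maximum) principle. -/
def DominationPrinciple (κ : X → X → ℝ≥0∞) : Prop :=
  ∀ μ ν : Measure X, memEplus κ μ → memEplus κ ν →
    (∀ᵐ x ∂μ, potential κ μ x ≤ potential κ ν x) →
    ∀ x : X, potential κ μ x ≤ potential κ ν x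

/-- `β` is the inner balayage of `ζ` onto `A`: `β ∈ E⁺(A)` and `U^β = U^ζ` n.e. on `A`. -/
def IsInnerBalayage (κ : X → X → ℝ≥0∞) (A : Set X) (ζ β : Measure X) : Prop :=
  memEplus κ β ∧ Concentrated β A ∧
    NearlyEverywhere κ A (fun x => potential κ β x = potential κ ζ x)

/-- `γ` is the inner capacitary measure of `A`: `γ ∈ E⁺(A)` and `U^γ = 1` n.e. on `A`. -/
def IsCapacitaryMeasure (κ : X → X → ℝ≥0∞) (A : Set X) (γ : Measure X) : Prop :=
  memEplus κ γ ∧ Concentrated γ A ∧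
    NearlyEverywhere κ A (fun x => potential κ γ x = 1)

/-- `A` is quasiclosed: approximable in outer capacity by closed sets. -/
def Quasiclosed (κ : X → X → ℝ≥0∞) (A : Set X) : Prop :=
  ∀ ε : ℝ≥0∞, 0 < ε → ∃ F : Set X, IsClosed F ∧ outerCap κ (symmDiff A F) < ε

/-- `A` is quasicompact: approximable in outer capacity by compact sets. -/
def Quasicompact (κ : X → X → ℝ≥0∞) (A : Set X) : Prop :=
  ∀ ε : ℝ≥0∞, 0 < ε → ∃ K : Set X, IsCompact K ∧ outerCap κ (symmDiff A K) < ε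


section SemicontinuousIntegral

variable {Y ι : Type*} [TopologicalSpace Y] [MeasurableSpace Y] [BorelSpace Y]

omit [BorelSpace Y] in
theorem measure_iUnion_of_directed_of_isOpen [Nonempty ι] (μ : Measure Y) [μ.Regular]
    {U : ι → Set Y} (hU : ∀ i, IsOpen (U i)) (hd : Directed (· ⊆ ·) U) :
    μ (⋃ i, U i) = ⨆ i, μ (U i) := by
  refine le_antisymm ?_ (iSup_le fun i => measure_mono (subset_iUnion U i))
  rw [(isOpen_iUnion hU).measure_eq_iSup_isCompact]
  refine iSup₂_le fun K hKU => iSup_le fun hK => ?_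
  obtain ⟨i, hi⟩ := hK.elim_directed_cover U hU hKU hd
  exact le_iSup_of_le i (measure_mono hi)

/-- The lower dyadic-type approximation `N⁻¹ · #{k < N² : (k+1)/N < t}` of `t`. -/
def stepApprox (N : ℕ) (t : ℝ≥0∞) : ℝ≥0∞ :=
  ∑ k ∈ Finset.range (N ^ 2), (N : ℝ≥0∞)⁻¹ * (Ioi ((k + 1 : ℝ≥0∞) / N)).indicator 1 t

theorem sum_step_le (N M : ℕ) (t : ℝ≥0∞) :
    ∑ k ∈ Finset.range M, (N : ℝ≥0∞)⁻¹ * (Ioi ((k + 1 : ℝ≥0∞) / N)).indicator 1 t ≤ t := by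
  suffices h : ∑ k ∈ Finset.range M, (N : ℝ≥0∞)⁻¹ * (Ioi ((k + 1 : ℝ≥0∞) / N)).indicator 1 t ≤ t ∧
      ∑ k ∈ Finset.range M, (N : ℝ≥0∞)⁻¹ * (Ioi ((k + 1 : ℝ≥0∞) / N)).indicator 1 t ≤
        (M : ℝ≥0∞) / N from h.1
  induction M with
  | zero => simp
  | succ M ih =>
    rw [Finset.sum_range_succ]
    have hstep : (M : ℝ≥0∞) / N + (N : ℝ≥0∞)⁻¹ = (M + 1 : ℝ≥0∞) / N := by
      rw [ENNReal.div_add_div_same.symm, one_div]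
    by_cases h : t ∈ Ioi ((M + 1 : ℝ≥0∞) / N)
    · rw [indicator_of_mem h, Pi.one_apply, mul_one]
      have h1 := (add_le_add_left ih.2 (N : ℝ≥0∞)⁻¹).trans_eq hstep
      exact ⟨h1.trans (le_of_lt h), by exact_mod_cast h1⟩
    · rw [indicator_of_notMem h, mul_zero, add_zero]
      refine ⟨ih.1, ih.2.trans ?_⟩
      gcongr
      simp

theorem le_liminf_stepApprox (t : ℝ≥0∞) :
    t ≤ liminf (fun N => stepApprox N t) atTop := by
  refine le_of_forall_lt fun c hc => ?_
  obtain ⟨b, hcb, hbt⟩ := ENNReal.lt_iff_exists_nnreal_btwn.1 hc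
  obtain ⟨a, hba, hat⟩ := ENNReal.lt_iff_exists_nnreal_btwn.1 hbt
  refine hcb.trans_le (le_liminf_of_le (by isBoundedDefault) ?_)
  rw [ENNReal.coe_lt_coe] at hba
  have hpos : 0 < a - b := tsub_pos_of_lt hba
  obtain ⟨n, hn⟩ := exists_nat_ge (max a (a - b)⁻¹)
  filter_upwards [eventually_ge_atTop (n + 1)] with N hN
  have hnN : (n : NNReal) ≤ N := by exact_mod_cast (Nat.le_succ n).trans hN
  have hN0 : (0 : NNReal) < N := by exact_mod_cast (Nat.succ_pos n).trans_le hN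
  have haN : a ≤ N := (le_max_left _ _).trans (hn.trans hnN)
  have hbN : (a - b)⁻¹ ≤ N := (le_max_right _ _).trans (hn.trans hnN)
  set m := ⌊(N : NNReal) * a⌋₊ with hm
  have hmle : (m : NNReal) ≤ N * a := Nat.floor_le (by positivity)
  have hmN : m ≤ N ^ 2 := by
    have : (m : NNReal) ≤ (N ^ 2 : ℕ) := hmle.trans (by push_cast; rw [sq]; gcongr)
    exact_mod_cast this
  have hkey : ((m : ℕ) : ℝ≥0∞) / N ≤ stepApprox N t := by
    calc ((m : ℕ) : ℝ≥0∞) / N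
        = ∑ k ∈ Finset.range m, (N : ℝ≥0∞)⁻¹ * (Ioi ((k + 1 : ℝ≥0∞) / N)).indicator 1 t := by
          rw [Finset.sum_congr rfl (g := fun _ => (N : ℝ≥0∞)⁻¹)]
          · simp [div_eq_mul_inv]
          · intro k hk
            rw [indicator_of_mem, Pi.one_apply, mul_one]
            refine lt_of_le_of_lt ?_ hat
            have : ((k : NNReal) + 1) / N ≤ a := by
              rw [div_le_iff₀ hN0, mul_comm]
              refine le_trans ?_ hmle
              exact_mod_cast Nat.succ_le_of_lt (Finset.mem_range.1 hk)
            have h2 : (((((k : NNReal) + 1) / N : NNReal)) : ℝ≥0∞) ≤ a := by exact_mod_cast this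
            rwa [ENNReal.coe_div hN0.ne', ENNReal.coe_add] at h2
      _ ≤ stepApprox N t :=
          Finset.sum_le_sum_of_subset (Finset.range_subset_range.2 hmN)
  refine le_trans ?_ hkey
  have : b ≤ (m : NNReal) / N := by
    rw [le_div_iff₀ hN0]
    have h1 : (N : NNReal) * a < m + 1 := Nat.lt_floor_add_one _
    have h2 : 1 ≤ (N : NNReal) * (a - b) := by
      calc (1 : NNReal) = (a - b)⁻¹ * (a - b) := by field_simp
        _ ≤ _ := by gcongr
    have h3 : (N : NNReal) * a = N * (a - b) + N * b := by
      rw [← mul_add, tsub_add_cancel_of_le hba.le]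
    rw [mul_comm b]
    have h4 : 1 + (N : NNReal) * b ≤ N * a := by rw [h3]; gcongr
    have h5 := h4.trans_lt h1
    rw [add_comm] at h5
    exact (lt_of_add_lt_add_right h5).le
  have h2 : (b : ℝ≥0∞) ≤ (((m : NNReal) / N : NNReal) : ℝ≥0∞) := by exact_mod_cast this
  rwa [ENNReal.coe_div hN0.ne'] at h2

/-- Monotone convergence for directed families of lower semicontinuous functions with respect to
a Radon measure. -/
theorem lintegral_iSup_of_directed_of_lowerSemicontinuous [Nonempty ι] (μ : Measure Y) [μ.Regular]
    {f : ι → Y → ℝ≥0∞} (hf : ∀ i, LowerSemicontinuous (f i)) (hd : Directed (· ≤ ·) f) :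
    ∫⁻ x, ⨆ i, f i x ∂μ = ⨆ i, ∫⁻ x, f i x ∂μ := by
  refine le_antisymm ?_ (iSup_le fun i => lintegral_mono fun x => le_iSup (fun i => f i x) i)
  have hopen : ∀ i (a : ℝ≥0∞), IsOpen {x | a < f i x} := fun i a => (hf i).isOpen_preimage a
  have hsup : ∀ a : ℝ≥0∞, {x | a < ⨆ i, f i x} = ⋃ i, {x | a < f i x} := by
    intro a; ext x; simp [lt_iSup_iff]
  have hmeas : ∀ a : ℝ≥0∞, MeasurableSet {x | a < ⨆ i, f i x} := fun a => by
    rw [hsup]; exact (isOpen_iUnion fun i => hopen i a).measurableSet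
  have hdir : ∀ a : ℝ≥0∞, Directed (· ⊆ ·) fun i => {x | a < f i x} := fun a =>
    hd.mono_comp (· ≤ ·) (g := fun (h : Y → ℝ≥0∞) => {x | a < h x})
      fun g h hgh x hx => lt_of_lt_of_le hx (hgh x)
  have hint : ∀ (N : ℕ) (g : Y → ℝ≥0∞), (∀ a, MeasurableSet {x | a < g x}) →
      ∫⁻ x, stepApprox N (g x) ∂μ =
        ∑ k ∈ Finset.range (N ^ 2), (N : ℝ≥0∞)⁻¹ * μ {x | (k + 1 : ℝ≥0∞) / N < g x} := by
    intro N g hg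
    have hrw : ∀ (a : ℝ≥0∞), (fun x => (Ioi a).indicator (1 : ℝ≥0∞ → ℝ≥0∞) (g x)) =
        {x | a < g x}.indicator 1 := fun a => by
      ext x; simp [indicator]
    have hm : ∀ a : ℝ≥0∞, Measurable fun x => (Ioi a).indicator (1 : ℝ≥0∞ → ℝ≥0∞) (g x) :=
      fun a => by rw [hrw]; exact measurable_one.indicator (hg a)
    simp only [stepApprox]
    rw [lintegral_finsetSum _ fun k _ => (hm _).const_mul _]
    refine Finset.sum_congr rfl fun k _ => ?_
    rw [lintegral_const_mul _ (hm _), hrw, lintegral_indicator_one (hg _)]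
  have hstep : ∀ N, ∫⁻ x, stepApprox N (⨆ i, f i x) ∂μ ≤ ⨆ i, ∫⁻ x, f i x ∂μ := by
    intro N
    rw [hint N _ hmeas]
    simp_rw [hsup, measure_iUnion_of_directed_of_isOpen μ (fun i => hopen i _) (hdir _),
      ENNReal.mul_iSup]
    rw [ENNReal.finsetSum_iSup]
    · refine iSup_mono fun i => ?_
      rw [← hint N _ fun a => (hopen i a).measurableSet]
      exact lintegral_mono fun x => sum_step_le N _ _
    · intro i j
      obtain ⟨k, hik, hjk⟩ := hd i j
      exact ⟨k, fun a => ⟨by gcongr; exact hik _, by gcongr; exact hjk _⟩⟩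
  calc ∫⁻ x, ⨆ i, f i x ∂μ
      ≤ ∫⁻ x, liminf (fun N => stepApprox N (⨆ i, f i x)) atTop ∂μ :=
        lintegral_mono fun x => le_liminf_stepApprox _
    _ ≤ liminf (fun N => ∫⁻ x, stepApprox N (⨆ i, f i x) ∂μ) atTop := by
        refine lintegral_liminf_le fun N => ?_
        have hg : Measurable fun x => ⨆ i, f i x := measurable_of_Ioi hmeas
        have hs : Measurable (stepApprox N) := Finset.measurable_fun_sum _ fun k _ =>
          (measurable_one.indicator measurableSet_Ioi).const_mul _
        exact hs.comp hg
    _ ≤ ⨆ i, ∫⁻ x, f i x ∂μ := liminf_le_of_le (by isBoundedDefault) fun b hb => by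
        obtain ⟨N, hN⟩ := hb.exists
        exact hN.trans (hstep N)

end SemicontinuousIntegral

section Potential

/-- Open rectangles carrying a constant which bounds `κ` from below. -/
abbrev MinorantRect (κ : X → X → ℝ≥0∞) : Type _ :=
  {p : Set X × Set X × ℝ≥0∞ //
    IsOpen p.1 ∧ IsOpen p.2.1 ∧ ∀ x ∈ p.1, ∀ y ∈ p.2.1, p.2.2 ≤ κ x y}

/-- The maximum of the step functions of finitely many minorant rectangles. -/
def rectApprox (κ : X → X → ℝ≥0∞) (s : Finset (MinorantRect κ)) (p : X × X) : ℝ≥0∞ :=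
  s.sup fun r => (r.1.1 ×ˢ r.1.2.1).indicator (fun _ => r.1.2.2) p

variable {κ : X → X → ℝ≥0∞} {μ ν : Measure X}

omit [MeasurableSpace X] in
theorem rectApprox_mono : Monotone (rectApprox κ) := fun _ _ h _ => Finset.sup_mono h

omit [MeasurableSpace X] in
theorem iSup_rectApprox (hκ : IsKernel κ) (x y : X) : ⨆ s, rectApprox κ s (x, y) = κ x y := by
  refine le_antisymm (iSup_le fun s => Finset.sup_le fun r _ => ?_) (le_of_forall_lt fun c hc => ?_)
  · by_cases h : (x, y) ∈ r.1.1 ×ˢ r.1.2.1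
    · rw [indicator_of_mem h]; exact r.2.2.2 x h.1 y h.2
    · rw [indicator_of_notMem h]; exact zero_le
  · obtain ⟨b, hcb, hb⟩ := exists_between hc
    have hopen : IsOpen {p : X × X | b < κ p.1 p.2} := hκ.2.isOpen_preimage b
    obtain ⟨U, V, hU, hV, hx, hy, hUV⟩ := isOpen_prod_iff.1 hopen x y hb
    let r : MinorantRect κ := ⟨(U, V, b), hU, hV, fun x' hx' y' hy' =>
      le_of_lt (hUV (show (x', y') ∈ U ×ˢ V from ⟨hx', hy'⟩))⟩
    refine hcb.trans_le (le_iSup_of_le {r} ?_)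
    simp [rectApprox, r, hx, hy]

omit [MeasurableSpace X] in
theorem lowerSemicontinuous_rectApprox_right (s : Finset (MinorantRect κ)) (x : X) :
    LowerSemicontinuous fun y => rectApprox κ s (x, y) := by
  simp only [rectApprox, Finset.sup_eq_iSup]
  refine lowerSemicontinuous_biSup fun r _ => ?_
  by_cases hx : x ∈ r.1.1
  · have : (fun y => (r.1.1 ×ˢ r.1.2.1).indicator (fun _ => r.1.2.2) (x, y)) =
        r.1.2.1.indicator fun _ => r.1.2.2 := by
      ext y; by_cases hy : y ∈ r.1.2.1 <;> simp [hx, hy]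
    rw [this]
    exact r.2.2.1.lowerSemicontinuous_indicator (zero_le)
  · have : (fun y => (r.1.1 ×ˢ r.1.2.1).indicator (fun _ => r.1.2.2) (x, y)) = fun _ => 0 := by
      ext y; simp [hx]
    rw [this]
    exact lowerSemicontinuous_const

theorem measurable_rectApprox [OpensMeasurableSpace X] (s : Finset (MinorantRect κ)) :
    Measurable (rectApprox κ s) := by
  unfold rectApprox
  simp only [Finset.sup_eq_iSup]
  exact Measurable.biSup _ s.countable_toSet fun r _ =>
    measurable_const.indicator (r.2.1.measurableSet.prod r.2.2.1.measurableSet)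

theorem lowerSemicontinuous_lintegral_rectApprox (s : Finset (MinorantRect κ)) (ν : Measure X) :
    LowerSemicontinuous fun x => ∫⁻ y, rectApprox κ s (x, y) ∂ν := by
  intro x c hc
  have h : ∀ᶠ z in 𝓝 x, ∀ r ∈ s, x ∈ r.1.1 → z ∈ r.1.1 :=
    (Finset.eventually_all s).2 fun r _ =>
      eventually_imp_distrib_left.2 fun hx => r.2.1.mem_nhds hx
  filter_upwards [h] with z hz
  refine lt_of_lt_of_le hc (lintegral_mono fun y => ?_)
  refine Finset.sup_mono_fun fun r hr => ?_
  by_cases hx : (x, y) ∈ r.1.1 ×ˢ r.1.2.1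
  · rw [indicator_of_mem hx, indicator_of_mem
      (show (z, y) ∈ r.1.1 ×ˢ r.1.2.1 from ⟨hz r hr hx.1, hx.2⟩)]
  · rw [indicator_of_notMem hx]; exact zero_le

variable [BorelSpace X]

theorem potential_eq_iSup (hκ : IsKernel κ) (ν : Measure X) [ν.Regular] (x : X) :
    potential κ ν x = ⨆ s, ∫⁻ y, rectApprox κ s (x, y) ∂ν := by
  rw [potential, ← lintegral_iSup_of_directed_of_lowerSemicontinuous ν
    (fun s => lowerSemicontinuous_rectApprox_right s x)
    (Monotone.directed_le fun s t h y => rectApprox_mono h (x, y))]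
  simp_rw [iSup_rectApprox hκ]

theorem lowerSemicontinuous_potential (hκ : IsKernel κ) (ν : Measure X) [ν.Regular] :
    LowerSemicontinuous (potential κ ν) := by
  have : potential κ ν = fun x => ⨆ s, ∫⁻ y, rectApprox κ s (x, y) ∂ν :=
    funext (potential_eq_iSup hκ ν)
  rw [this]
  exact lowerSemicontinuous_iSup fun s => lowerSemicontinuous_lintegral_rectApprox s ν

theorem measurable_potential (hκ : IsKernel κ) (ν : Measure X) [ν.Regular] :
    Measurable (potential κ ν) :=
  (lowerSemicontinuous_potential hκ ν).measurable

theorem mutualEnergy_eq_lintegral_of_aemeasurable (hκ : IsKernel κ) (μ ν : Measure X) [μ.Regular]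
    [ν.Regular] (h : AEMeasurable (fun x : X => ν.map (Prod.mk x)) μ) :
    mutualEnergy κ μ ν = ∫⁻ x, potential κ ν x ∂μ := by
  refine le_antisymm (lintegral_prod_le _) ?_
  simp_rw [potential_eq_iSup hκ ν]
  rw [lintegral_iSup_of_directed_of_lowerSemicontinuous μ
    (fun s => lowerSemicontinuous_lintegral_rectApprox s ν)
    (Monotone.directed_le fun s t h x => lintegral_mono fun y => rectApprox_mono h (x, y))]
  refine iSup_le fun s => ?_
  have hm := measurable_rectApprox s
  calc ∫⁻ x, ∫⁻ y, rectApprox κ s (x, y) ∂ν ∂μ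
      = ∫⁻ p, rectApprox κ s p ∂(μ.prod ν) := by
        rw [Measure.prod, Measure.lintegral_bind h hm.aemeasurable]
        refine lintegral_congr fun x => ?_
        rw [lintegral_map hm measurable_prodMk_left]
    _ ≤ mutualEnergy κ μ ν := lintegral_mono fun p => by
        rw [← iSup_rectApprox hκ p.1 p.2]
        exact le_iSup (fun s => rectApprox κ s p) s

theorem mutualEnergy_eq_lintegral (hκ : IsKernel κ) (μ ν : Measure X) [μ.Regular]
    [ν.Regular] [SFinite ν] : mutualEnergy κ μ ν = ∫⁻ x, potential κ ν x ∂μ :=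
  mutualEnergy_eq_lintegral_of_aemeasurable hκ μ ν Measurable.map_prodMk_left.aemeasurable

omit [BorelSpace X] [TopologicalSpace X] in
theorem mutualEnergy_eq_zero_of_not_aemeasurable
    (h : ¬ AEMeasurable (fun x : X => ν.map (Prod.mk x)) μ) : mutualEnergy κ μ ν = 0 := by
  rw [mutualEnergy, Measure.prod, Measure.bind, Measure.map_of_not_aemeasurable h]
  simp

omit [BorelSpace X] in
theorem mutualEnergy_comm (hκ : IsKernel κ) (μ ν : Measure X) [SFinite μ] [SFinite ν] :
    mutualEnergy κ μ ν = mutualEnergy κ ν μ := by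
  rw [mutualEnergy, ← lintegral_prod_swap]
  simp only [Prod.fst_swap, Prod.snd_swap, mutualEnergy]
  exact lintegral_congr fun p => hκ.1 _ _

end Potential

section Radon

variable [BorelSpace X] {κ : X → X → ℝ≥0∞} {μ ν τ : Measure X} {A : Set X}

omit [BorelSpace X] in
theorem regular_add [μ.Regular] [ν.Regular] : (μ + ν).Regular where
  lt_top_of_isCompact K hK := by
    rw [Measure.add_apply]
    exact ENNReal.add_lt_top.2 ⟨hK.measure_lt_top, hK.measure_lt_top⟩
  outerRegular S hS r hr := by
    rw [gt_iff_lt, Measure.add_apply] at hr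
    have hμ : μ S ≠ ⊤ := (le_self_add.trans_lt (hr.trans_le le_top)).ne
    have hν : ν S ≠ ⊤ := (le_add_self.trans_lt (hr.trans_le le_top)).ne
    obtain ⟨δ, hδ, hr'⟩ := ENNReal.lt_iff_exists_add_pos_lt.1 hr
    have hδ' : (δ / 2 : ℝ≥0∞) ≠ 0 := (ENNReal.half_pos (by exact_mod_cast hδ.ne')).ne'
    obtain ⟨U, hSU, hU, hμU⟩ := S.exists_isOpen_lt_add hμ hδ'
    obtain ⟨V, hSV, hV, hνV⟩ := S.exists_isOpen_lt_add hν hδ'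
    refine ⟨U ∩ V, subset_inter hSU hSV, hU.inter hV, ?_⟩
    calc (μ + ν) (U ∩ V) ≤ μ U + ν V := by
          rw [Measure.add_apply]
          exact add_le_add (measure_mono inter_subset_left) (measure_mono inter_subset_right)
      _ ≤ (μ S + δ / 2) + (ν S + δ / 2) := add_le_add hμU.le hνV.le
      _ = μ S + ν S + δ := by rw [add_add_add_comm, ENNReal.add_halves]
      _ < r := hr'
  innerRegular U hU r hr := by
    by_contra! hn
    have hsup : ∀ ρ : Measure X, ρ.Regular →
        ρ U = ⨆ (K : Set X) (_ : K ⊆ U ∧ IsCompact K), ρ K := fun ρ _ => by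
      rw [hU.measure_eq_iSup_isCompact]; simp only [iSup_and]
    rw [Measure.add_apply, hsup μ ‹_›, hsup ν ‹_›] at hr
    refine hr.not_ge (ENNReal.biSup_add_biSup_le' ⟨∅, empty_subset _, isCompact_empty⟩
      ⟨∅, empty_subset _, isCompact_empty⟩ fun K hK L hL => ?_)
    refine le_trans ?_ (hn (K ∪ L) (union_subset hK.1 hL.1) (hK.2.union hL.2))
    rw [Measure.add_apply]
    exact add_le_add (measure_mono subset_union_left) (measure_mono subset_union_right)

theorem regular_dirac [T2Space X] (x : X) : (Measure.dirac x).Regular where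
  lt_top_of_isCompact K _ := measure_lt_top _ K
  outerRegular S hS r hr := by
    by_cases hx : x ∈ S
    · refine ⟨univ, subset_univ S, isOpen_univ, ?_⟩
      rw [gt_iff_lt, Measure.dirac_apply_of_mem hx] at hr
      simpa using hr
    · refine ⟨{x}ᶜ, fun y hy hyx => hx (hyx ▸ hy), isOpen_compl_singleton, ?_⟩
      simpa using hr.trans_le' zero_le
  innerRegular U hU r hr := by
    rw [Measure.dirac_apply' _ hU.measurableSet] at hr
    by_cases hx : x ∈ U
    · refine ⟨{x}, singleton_subset_iff.2 hx, isCompact_singleton, ?_⟩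
      simpa [hx] using hr
    · simp [hx] at hr

omit [BorelSpace X] in
theorem memEplus_zero : memEplus κ (0 : Measure X) :=
  ⟨(inferInstance : (0 : Measure X).Regular), by simp [energy, mutualEnergy]⟩

omit [BorelSpace X] in
theorem EnergyPrinciple.eq_zero (h : EnergyPrinciple κ) (hμ : Measure.Regular μ)
    (h0 : energy κ μ = 0) : μ = 0 := by
  refine (h μ 0 ⟨hμ, by simp [h0]⟩ memEplus_zero).2 ?_
  rw [h0]
  simp [energy, mutualEnergy]

theorem EnergyPrinciple.diag_pos [T2Space X] (h : EnergyPrinciple κ) (x : X) : 0 < κ x x := by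
  rw [pos_iff_ne_zero]
  intro h0
  have : Measure.dirac x = (0 : Measure X) := by
    refine h.eq_zero (regular_dirac x) ?_
    rw [energy, mutualEnergy, Measure.dirac_prod_dirac, ← nonpos_iff_eq_zero, ← h0]
    have hm : ∀ g : SimpleFunc (X × X) ℝ≥0∞, ⇑g ≤ (fun p : X × X => κ p.1 p.2) →
        g.lintegral (Measure.dirac (x, x)) ≤ κ x x := fun g hg => by
      rw [← SimpleFunc.lintegral_eq_lintegral, lintegral_dirac' _ g.measurable]
      exact hg (x, x)
    rw [lintegral]
    exact iSup₂_le hm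
  exact Measure.dirac_ne_zero this

theorem measure_potential_eq_zero [T2Space X] (hκ : IsKernel κ) (h : EnergyPrinciple κ)
    [μ.Regular] : μ {x | potential κ μ x = 0} = 0 := by
  let G : Set X := ⋃₀ {U | IsOpen U ∧ μ U = 0}
  have hG : IsOpen G := isOpen_sUnion fun U hU => hU.1
  have hsub : {x | potential κ μ x = 0} ⊆ G := by
    intro x hx
    obtain ⟨c, hc0, hc⟩ := exists_between (h.diag_pos x)
    obtain ⟨U, V, hU, hV, hxU, hxV, hUV⟩ := isOpen_prod_iff.1 (hκ.2.isOpen_preimage c) x x hc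
    refine ⟨V, ⟨hV, ?_⟩, hxV⟩
    have h1 : c * μ V ≤ potential κ μ x := by
      rw [← setLIntegral_const]
      refine (setLIntegral_mono' hV.measurableSet fun y hy => ?_).trans
        (setLIntegral_le_lintegral V _)
      exact le_of_lt (hUV (show (x, y) ∈ U ×ˢ V from ⟨hxU, hy⟩))
    rw [hx, nonpos_iff_eq_zero, mul_eq_zero] at h1
    exact h1.resolve_left hc0.ne'
  refine measure_mono_null hsub ?_
  rw [hG.measure_eq_iSup_isCompact, ENNReal.iSup_eq_zero]
  refine fun K => ENNReal.iSup_eq_zero.2 fun hKG => ENNReal.iSup_eq_zero.2 fun hK => ?_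
  refine hK.measure_zero_of_nhdsWithin fun x hx => ?_
  obtain ⟨U, hU, hxU⟩ := hKG hx
  exact ⟨U, mem_nhdsWithin_of_mem_nhds (hU.1.mem_nhds hxU), hU.2⟩

/-- Measures of finite energy are `σ`-finite. -/
theorem memEplus.sigmaFinite [T2Space X] (hκ : IsKernel κ) (h : EnergyPrinciple κ)
    (hμ : memEplus κ μ) : SigmaFinite μ := by
  have : μ.Regular := hμ.1
  by_cases hm : AEMeasurable (fun x : X => μ.map (Prod.mk x)) μ
  · have hint : ∫⁻ x, potential κ μ x ∂μ ≠ ⊤ := by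
      rw [← mutualEnergy_eq_lintegral_of_aemeasurable hκ μ μ hm]
      exact hμ.2.ne
    refine ⟨⟨⟨fun n => {x | potential κ μ x = 0} ∪ {x | ((n : ℝ≥0∞) + 1)⁻¹ ≤ potential κ μ x},
      fun _ => trivial, fun n => ?_, ?_⟩⟩⟩
    · refine (measure_union_le _ _).trans_lt ?_
      rw [measure_potential_eq_zero hκ h, zero_add]
      refine (meas_ge_le_lintegral_div (measurable_potential hκ μ).aemeasurable
        (by simp) (by simp)).trans_lt ?_
      exact ENNReal.div_lt_top hint (by simp)
    · refine eq_univ_of_forall fun x => mem_iUnion.2 ?_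
      by_cases hx : potential κ μ x = 0
      · exact ⟨0, Or.inl hx⟩
      · obtain ⟨n, hn⟩ := ENNReal.exists_inv_nat_lt hx
        exact ⟨n, Or.inr ((ENNReal.inv_le_inv.2 le_self_add).trans hn.le)⟩
  · rw [h.eq_zero hμ.1 (mutualEnergy_eq_zero_of_not_aemeasurable hm)]
    infer_instance

theorem Concentrated.measure_compl [T2Space X] [μ.Regular] [SigmaFinite μ]
    (h : Concentrated μ A) : μ Aᶜ = 0 := by
  have hS : ∀ n, μ (Aᶜ ∩ spanningSets μ n) = 0 := fun n => by
    refine le_antisymm (ENNReal.le_of_forall_pos_le_add fun ε hε _ => ?_) zero_le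
    obtain ⟨K, hKS, hK, hKε⟩ := (measurableSet_spanningSets μ n).exists_isCompact_sdiff_lt
      (measure_spanningSets_lt_top μ n).ne (ε := ε) (by exact_mod_cast hε.ne')
    calc μ (Aᶜ ∩ spanningSets μ n) ≤ μ (Aᶜ ∩ K ∪ spanningSets μ n \ K) :=
          measure_mono fun x hx => by
            by_cases hxK : x ∈ K
            · exact Or.inl ⟨hx.1, hxK⟩
            · exact Or.inr ⟨hx.2, hxK⟩
      _ ≤ μ (Aᶜ ∩ K) + μ (spanningSets μ n \ K) := measure_union_le _ _
      _ ≤ 0 + ε := by rw [h K hK]; gcongr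
  have := measure_iUnion_null hS
  rwa [← inter_iUnion, iUnion_spanningSets, inter_univ] at this

end Radon

section EnergyForm

variable {κ : X → X → ℝ≥0∞} {μ μ' ν τ : Measure X} {A : Set X}

omit [TopologicalSpace X] in
theorem mutualEnergy_add_left [SFinite μ] [SFinite μ'] [SFinite ν] :
    mutualEnergy κ (μ + μ') ν = mutualEnergy κ μ ν + mutualEnergy κ μ' ν := by
  simp [mutualEnergy, Measure.add_prod]

omit [TopologicalSpace X] in
theorem mutualEnergy_add_right [SFinite μ] [SFinite μ'] [SFinite ν] :
    mutualEnergy κ ν (μ + μ') = mutualEnergy κ ν μ + mutualEnergy κ ν μ' := by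
  simp [mutualEnergy, Measure.prod_add]

omit [TopologicalSpace X] in
theorem mutualEnergy_smul_left [SFinite ν] (c : NNReal) :
    mutualEnergy κ (c • μ) ν = c * mutualEnergy κ μ ν := by
  rw [mutualEnergy, Measure.prod_smul_left, lintegral_smul_measure]; rfl

omit [TopologicalSpace X] in
theorem mutualEnergy_smul_right [SFinite ν] (c : NNReal) :
    mutualEnergy κ μ (c • ν) = c * mutualEnergy κ μ ν := by
  rw [mutualEnergy, Measure.prod_smul_right, lintegral_smul_measure]; rfl

theorem EnergyPrinciple.mutualEnergy_lt_top (h : EnergyPrinciple κ) (hμ : memEplus κ μ)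
    (hν : memEplus κ ν) : mutualEnergy κ μ ν < ⊤ := by
  have h1 := (h μ ν hμ hν).1.trans_lt (ENNReal.add_lt_top.2 ⟨hμ.2, hν.2⟩)
  exact lt_of_le_of_lt (le_mul_of_one_le_left zero_le one_le_two) h1

variable [BorelSpace X] [T2Space X]

theorem memEplus.smul (hκ : IsKernel κ) (h : EnergyPrinciple κ) (hμ : memEplus κ μ)
    (c : NNReal) : memEplus κ (c • μ) := by
  have : μ.Regular := hμ.1
  have := hμ.sigmaFinite hκ h
  refine ⟨(inferInstance : (c • μ).Regular), ?_⟩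
  rw [energy, mutualEnergy_smul_left, mutualEnergy_smul_right]
  exact ENNReal.mul_lt_top coe_lt_top (ENNReal.mul_lt_top coe_lt_top hμ.2)

theorem memEplus.add (hκ : IsKernel κ) (h : EnergyPrinciple κ) (hμ : memEplus κ μ)
    (hν : memEplus κ ν) : memEplus κ (μ + ν) := by
  have : μ.Regular := hμ.1
  have : ν.Regular := hν.1
  have := hμ.sigmaFinite hκ h
  have := hν.sigmaFinite hκ h
  refine ⟨regular_add, ?_⟩
  rw [energy, mutualEnergy_add_left, mutualEnergy_add_right, mutualEnergy_add_right]
  exact ENNReal.add_lt_top.2 ⟨ENNReal.add_lt_top.2 ⟨hμ.2, h.mutualEnergy_lt_top hμ hν⟩,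
    ENNReal.add_lt_top.2 ⟨h.mutualEnergy_lt_top hν hμ, hν.2⟩⟩

theorem memEplus.restrict (hκ : IsKernel κ) (h : EnergyPrinciple κ) (hμ : memEplus κ μ)
    {S : Set X} (hS : μ S ≠ ⊤) :
    memEplus κ (μ.restrict S) := by
  have : μ.Regular := hμ.1
  have := hμ.sigmaFinite hκ h
  refine ⟨Measure.Regular.restrict_of_measure_ne_top hS, lt_of_le_of_lt ?_ hμ.2⟩
  exact lintegral_mono' (Measure.prod_mono Measure.restrict_le_self Measure.restrict_le_self) le_rfl

/-- The real-valued mutual energy. -/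
def pairing (κ : X → X → ℝ≥0∞) (μ ν : Measure X) : ℝ := (mutualEnergy κ μ ν).toReal

theorem pairing_comm (hκ : IsKernel κ) (h : EnergyPrinciple κ) (hμ : memEplus κ μ)
    (hν : memEplus κ ν) : pairing κ μ ν = pairing κ ν μ := by
  have := hμ.sigmaFinite hκ h
  have := hν.sigmaFinite hκ h
  rw [pairing, pairing, mutualEnergy_comm hκ]

theorem pairing_add_left (hκ : IsKernel κ) (h : EnergyPrinciple κ) (hμ : memEplus κ μ)
    (hμ' : memEplus κ μ') (hν : memEplus κ ν) :
    pairing κ (μ + μ') ν = pairing κ μ ν + pairing κ μ' ν := by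
  have := hμ.sigmaFinite hκ h
  have := hμ'.sigmaFinite hκ h
  have := hν.sigmaFinite hκ h
  rw [pairing, mutualEnergy_add_left, ENNReal.toReal_add (h.mutualEnergy_lt_top hμ hν).ne
    (h.mutualEnergy_lt_top hμ' hν).ne]
  rfl

theorem pairing_add_right (hκ : IsKernel κ) (h : EnergyPrinciple κ) (hμ : memEplus κ μ)
    (hμ' : memEplus κ μ') (hν : memEplus κ ν) :
    pairing κ ν (μ + μ') = pairing κ ν μ + pairing κ ν μ' := by
  rw [pairing_comm hκ h hν (hμ.add hκ h hμ'), pairing_add_left hκ h hμ hμ' hν,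
    pairing_comm hκ h hμ hν, pairing_comm hκ h hμ' hν]

theorem pairing_smul_left (hκ : IsKernel κ) (h : EnergyPrinciple κ) (hν : memEplus κ ν)
    (c : NNReal) : pairing κ (c • μ) ν = c * pairing κ μ ν := by
  have := hν.sigmaFinite hκ h
  simp [pairing, mutualEnergy_smul_left]

theorem pairing_smul_right (hκ : IsKernel κ) (h : EnergyPrinciple κ) (hν : memEplus κ ν)
    (c : NNReal) : pairing κ μ (c • ν) = c * pairing κ μ ν := by
  have := hν.sigmaFinite hκ h
  simp [pairing, mutualEnergy_smul_right]

omit [BorelSpace X] [T2Space X] in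
theorem two_mul_pairing_le (h : EnergyPrinciple κ) (hμ : memEplus κ μ) (hν : memEplus κ ν) :
    2 * pairing κ μ ν ≤ pairing κ μ μ + pairing κ ν ν := by
  have h1 := ENNReal.toReal_mono (ENNReal.add_lt_top.2 ⟨hμ.2, hν.2⟩).ne (h μ ν hμ hν).1
  rwa [ENNReal.toReal_mul, ENNReal.toReal_add hμ.2.ne hν.2.ne] at h1

omit [BorelSpace X] [T2Space X] in
theorem eq_of_le_two_mul_pairing (h : EnergyPrinciple κ) (hμ : memEplus κ μ)
    (hν : memEplus κ ν) (hle : pairing κ μ μ + pairing κ ν ν ≤ 2 * pairing κ μ ν) : μ = ν := by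
  refine (h μ ν hμ hν).2 ?_
  rw [← ENNReal.toReal_eq_toReal_iff' (ENNReal.mul_lt_top (by simp)
    (h.mutualEnergy_lt_top hμ hν)).ne (ENNReal.add_lt_top.2 ⟨hμ.2, hν.2⟩).ne,
    ENNReal.toReal_mul, ENNReal.toReal_add hμ.2.ne hν.2.ne]
  exact le_antisymm (two_mul_pairing_le h hμ hν) hle

theorem sq_pairing_sub_le (hκ : IsKernel κ) (h : EnergyPrinciple κ) (hμ : memEplus κ μ)
    (hμ' : memEplus κ μ') (hν : memEplus κ ν) :
    (pairing κ μ ν - pairing κ μ' ν) ^ 2 ≤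
      (pairing κ μ μ + pairing κ μ' μ' - 2 * pairing κ μ μ') * pairing κ ν ν := by
  have key : ∀ (t : NNReal) {α α' : Measure X}, memEplus κ α → memEplus κ α' →
      0 ≤ pairing κ ν ν * (t * t) + 2 * (pairing κ α ν - pairing κ α' ν) * t +
        (pairing κ α α + pairing κ α' α' - 2 * pairing κ α α') := fun t α α' hα hα' => by
    have htν := hν.smul hκ h t
    have h1 := two_mul_pairing_le h (hα.add hκ h htν) hα'
    rw [pairing_add_left hκ h hα htν hα', pairing_add_left hκ h hα htν (hα.add hκ h htν),
      pairing_add_right hκ h hα htν hα, pairing_add_right hκ h hα htν htν,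
      pairing_smul_left hκ h hα, pairing_smul_left hκ h hα', pairing_smul_left hκ h htν,
      pairing_smul_right hκ h hν, pairing_smul_right hκ h hν, pairing_comm hκ h hν hα,
      pairing_comm hκ h hν hα'] at h1
    linarith
  have hd := discrim_le_zero (a := pairing κ ν ν) (b := 2 * (pairing κ μ ν - pairing κ μ' ν))
    (c := pairing κ μ μ + pairing κ μ' μ' - 2 * pairing κ μ μ') fun x => by
      rcases le_total 0 x with hx | hx
      · exact key ⟨x, hx⟩ hμ hμ'
      · have h1 := key (-x).toNNReal hμ' hμ
        rw [Real.coe_toNNReal _ (neg_nonneg.2 hx), pairing_comm hκ h hμ' hμ] at h1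
        linarith
  rw [discrim] at hd
  linarith

theorem lintegral_potential (hκ : IsKernel κ) (h : EnergyPrinciple κ) (hμ : memEplus κ μ)
    (hν : memEplus κ ν) : ∫⁻ x, potential κ ν x ∂μ = mutualEnergy κ μ ν := by
  have : μ.Regular := hμ.1
  have : ν.Regular := hν.1
  have := hν.sigmaFinite hκ h
  rw [mutualEnergy_eq_lintegral hκ]

end EnergyForm

section NearlyEverywhere

variable [BorelSpace X] [T2Space X] {κ : X → X → ℝ≥0∞} {τ : Measure X} {A : Set X}

/-- A finite-energy measure charging a measurable set can be localized to that set and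
normalized. -/
theorem exists_memBreve_of_measure_ne_zero (hκ : IsKernel κ) (h : EnergyPrinciple κ)
    (hτ : memEplus κ τ) (hτA : Concentrated τ A) {S : Set X} (hS : MeasurableSet S)
    (h0 : τ S ≠ 0) : ∃ σ, memBreve κ A σ ∧ σ Sᶜ = 0 := by
  have := hτ.sigmaFinite hκ h
  obtain ⟨T, hT, hTS, hT0, hTtop⟩ :=
    Measure.exists_subset_measure_lt_top hS (pos_iff_ne_zero.2 h0)
  set c : NNReal := (τ T).toNNReal⁻¹
  have hc : (c : ℝ≥0∞) * τ T = 1 := by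
    rw [ENNReal.coe_inv (ENNReal.toNNReal_ne_zero.2 ⟨hT0.ne', hTtop.ne⟩),
      ENNReal.coe_toNNReal hTtop.ne, ENNReal.inv_mul_cancel hT0.ne' hTtop.ne]
  have hle : ∀ s, τ s = 0 → (c • τ.restrict T) s = 0 := fun s hs => by
    rw [Measure.smul_apply, le_antisymm ((Measure.restrict_le_self s).trans_eq hs) zero_le,
      smul_zero]
  refine ⟨c • τ.restrict T, ⟨(hτ.restrict hκ h hTtop.ne).smul hκ h c,
    fun K hK => hle _ (hτA K hK), ?_⟩, ?_⟩
  · rw [Measure.smul_apply, Measure.restrict_apply_univ, ← hc]; rfl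
  · rw [Measure.smul_apply, Measure.restrict_apply hS.compl,
      (disjoint_compl_left_iff_subset.2 hTS).inter_eq, measure_empty, smul_zero]

theorem nearlyEverywhere_of_forall_ae (hκ : IsKernel κ) (h : EnergyPrinciple κ) {P : X → Prop}
    (hP : ∀ τ, memEplus κ τ → Concentrated τ A → ∀ᵐ x ∂τ, P x) : NearlyEverywhere κ A P := by
  rw [NearlyEverywhere, innerCap, ENNReal.inv_eq_zero, wcap, iInf_eq_top]
  refine fun τ => iInf_eq_top.2 fun hτ => ?_
  exfalso
  have : τ.Regular := hτ.1.1
  have := hτ.1.sigmaFinite hκ h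
  have hN := hτ.2.1.measure_compl
  have hA : Concentrated τ A := fun K hK =>
    measure_mono_null (inter_subset_inter_left K (compl_subset_compl.2 fun x hx => hx.1))
      (hτ.2.1 K hK)
  have hae := hP τ hτ.1 hA
  have huniv : τ univ = 0 := by
    refine measure_mono_null (fun x _ => ?_) (measure_union_null hN (ae_iff.1 hae))
    by_cases hx : P x
    · exact Or.inl fun hxN => hxN.2 hx
    · exact Or.inr hx
  rw [hτ.2.2] at huniv
  exact one_ne_zero huniv

theorem NearlyEverywhere.ae (hκ : IsKernel κ) (h : EnergyPrinciple κ) {P : X → Prop}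
    (hne : NearlyEverywhere κ A P) (hP : MeasurableSet {x | P x}) (hτ : memEplus κ τ)
    (hτA : Concentrated τ A) : ∀ᵐ x ∂τ, P x := by
  rw [ae_iff]
  by_contra h0
  obtain ⟨σ, hσ, hσS⟩ := exists_memBreve_of_measure_ne_zero hκ h hτ hτA hP.compl h0
  rw [NearlyEverywhere, innerCap, ENNReal.inv_eq_zero] at hne
  have hσN : memBreve κ {x ∈ A | ¬ P x} σ := by
    refine ⟨hσ.1, fun K hK => ?_, hσ.2.2⟩
    refine measure_mono_null (fun x hx => ?_) (measure_union_null (hσ.2.1 K hK) hσS)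
    by_cases hxA : x ∈ A
    · exact Or.inr fun hxP => hx.1 ⟨hxA, hxP⟩
    · exact Or.inl ⟨hxA, hx.2⟩
  have hle : wcap κ {x ∈ A | ¬ P x} ≤ energy κ σ := iInf₂_le σ hσN
  rw [hne] at hle
  exact hσ.1.2.not_ge hle

theorem memEplus.ae_potential_lt_top (hκ : IsKernel κ) (h : EnergyPrinciple κ)
    (hτ : memEplus κ τ) {ζ : Measure X} (hζ : memEplus κ ζ) : ∀ᵐ x ∂τ, potential κ ζ x < ⊤ := by
  have : ζ.Regular := hζ.1
  refine ae_lt_top (measurable_potential hκ ζ) ?_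
  rw [lintegral_potential hκ h hτ hζ]
  exact (h.mutualEnergy_lt_top hτ hζ).ne

end NearlyEverywhere

section Equilibrium

variable [BorelSpace X] [T2Space X] {κ : X → X → ℝ≥0∞} {A : Set X}

omit [BorelSpace X] [T2Space X] in
theorem wcap_toReal_le {σ : Measure X} (hσ : memBreve κ A σ) :
    (wcap κ A).toReal ≤ pairing κ σ σ :=
  ENNReal.toReal_mono hσ.1.2.ne (iInf₂_le σ hσ)

theorem memBreve.convex (hκ : IsKernel κ) (h : EnergyPrinciple κ) {σ τ : Measure X}
    (hσ : memBreve κ A σ) (hτ : memBreve κ A τ) (a b : NNReal) (hab : a + b = 1) :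
    memBreve κ A (a • σ + b • τ) := by
  refine ⟨(hσ.1.smul hκ h a).add hκ h (hτ.1.smul hκ h b), fun K hK => ?_, ?_⟩
  · rw [Measure.add_apply, Measure.smul_apply, Measure.smul_apply, hσ.2.1 K hK, hτ.2.1 K hK]
    simp
  · rw [Measure.add_apply, Measure.smul_apply, Measure.smul_apply, hσ.2.2, hτ.2.2]
    rw [ENNReal.smul_def, ENNReal.smul_def, smul_eq_mul, smul_eq_mul, mul_one, mul_one,
      ← ENNReal.coe_add, hab, ENNReal.coe_one]

theorem wcap_mul_sq_le (hκ : IsKernel κ) (h : EnergyPrinciple κ)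
    {σ τ : Measure X} (hσ : memBreve κ A σ) (hτ : memBreve κ A τ) (t : NNReal) :
    (wcap κ A).toReal * (1 + t) ^ 2 ≤
      pairing κ σ σ + 2 * t * pairing κ σ τ + t ^ 2 * pairing κ τ τ := by
  have h1t : (0 : NNReal) < 1 + t := by positivity
  set a : NNReal := (1 + t)⁻¹ with ha
  have hρ := hσ.convex hκ h hτ a (a * t) (by rw [ha]; field_simp)
  have hle := wcap_toReal_le hρ
  have hσ1 := hσ.1.smul hκ h a
  have hτ1 := hτ.1.smul hκ h (a * t)
  rw [pairing_add_left hκ h hσ1 hτ1 hρ.1, pairing_add_right hκ h hσ1 hτ1 hσ1,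
    pairing_add_right hκ h hσ1 hτ1 hτ1, pairing_smul_left hκ h hσ1, pairing_smul_left hκ h hσ1,
    pairing_smul_left hκ h hτ1, pairing_smul_left hκ h hτ1, pairing_smul_right hκ h hσ.1,
    pairing_smul_right hκ h hτ.1, pairing_smul_right hκ h hσ.1, pairing_smul_right hκ h hτ.1,
    pairing_comm hκ h hτ.1 hσ.1] at hle
  have hacoe : (a : ℝ) * (1 + t) = 1 := by
    rw [ha]; push_cast; field_simp
  have h2 := mul_le_mul_of_nonneg_right hle (sq_nonneg (1 + (t : ℝ)))
  refine h2.trans_eq ?_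
  push_cast
  linear_combination (a * (1 + (t : ℝ)) + 1) * (pairing κ σ σ + 2 * t * pairing κ σ τ +
    t ^ 2 * pairing κ τ τ) * hacoe

omit [BorelSpace X] [T2Space X] in
theorem exists_minimizing_seq (hw : wcap κ A ≠ ⊤) : ∃ σ : ℕ → Measure X,
    (∀ n, memBreve κ A (σ n)) ∧
      Tendsto (fun n => pairing κ (σ n) (σ n)) atTop (𝓝 (wcap κ A).toReal) := by
  have hex : ∀ n : ℕ, ∃ σ, memBreve κ A σ ∧ energy κ σ < wcap κ A + ((n : ℝ≥0∞) + 1)⁻¹ := by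
    intro n
    have hlt : wcap κ A < wcap κ A + ((n : ℝ≥0∞) + 1)⁻¹ :=
      ENNReal.lt_add_right hw (by simp)
    conv_lhs at hlt => rw [wcap]
    obtain ⟨σ, hσ⟩ := iInf_lt_iff.1 hlt
    obtain ⟨hσ, hσ'⟩ := iInf_lt_iff.1 hσ
    exact ⟨σ, hσ, hσ'⟩
  choose σ hσ hσe using hex
  refine ⟨σ, hσ, tendsto_of_tendsto_of_tendsto_of_le_of_le tendsto_const_nhds
    (h := fun n : ℕ => (wcap κ A).toReal + 1 / ((n : ℝ) + 1)) ?_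
    (fun n => wcap_toReal_le (hσ n)) fun n => ?_⟩
  · simpa using (tendsto_one_div_add_atTop_nhds_zero_nat (𝕜 := ℝ)).const_add (wcap κ A).toReal
  · have h1 := ENNReal.toReal_mono (ENNReal.add_lt_top.2 ⟨hw.lt_top, by simp⟩).ne (hσe n).le
    rw [ENNReal.toReal_add hw (by simp)] at h1
    have h2 : ((n : ℝ≥0∞) + 1).toReal = n + 1 := by
      rw [ENNReal.toReal_add (by simp) (by simp)]; simp
    simpa [pairing, energy, h2] using h1

theorem strongCauchySeq_of_minimizing (hκ : IsKernel κ) (h : EnergyPrinciple κ)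
    {σ : ℕ → Measure X} (hσ : ∀ n, memBreve κ A (σ n))
    (hlim : Tendsto (fun n => pairing κ (σ n) (σ n)) atTop (𝓝 (wcap κ A).toReal)) :
    StrongCauchySeq κ σ := by
  intro ε hε
  have hev : ∀ᶠ n in atTop, pairing κ (σ n) (σ n) < (wcap κ A).toReal + ε ^ 2 / 4 :=
    hlim.eventually_lt_const (by linarith [pow_pos hε 2])
  obtain ⟨N, hN⟩ := eventually_atTop.1 hev
  refine ⟨N, fun m hm n hn => ?_⟩
  rw [strongDist, Real.sqrt_lt' hε]
  have h1 := wcap_mul_sq_le hκ h (hσ m) (hσ n) 1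
  have h2 := hN m hm
  have h3 := hN n hn
  simp only [NNReal.coe_one] at h1
  simp only [pairing] at h1 h2 h3
  simp only [energy]
  linarith

theorem StrongTendstoSeq.tendsto_pairing (hκ : IsKernel κ) (h : EnergyPrinciple κ)
    {σ : ℕ → Measure X} {μ ν : Measure X} (hσ : ∀ n, memEplus κ (σ n)) (hμ : memEplus κ μ)
    (hν : memEplus κ ν) (hlim : StrongTendstoSeq κ σ μ) :
    Tendsto (fun n => pairing κ (σ n) ν) atTop (𝓝 (pairing κ μ ν)) := by
  rw [tendsto_iff_norm_sub_tendsto_zero]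
  have hb : Tendsto (fun n => strongDist κ (σ n) μ * Real.sqrt (pairing κ ν ν)) atTop (𝓝 0) := by
    have := Tendsto.mul_const (Real.sqrt (pairing κ ν ν)) hlim
    rwa [zero_mul] at this
  refine squeeze_zero (fun n => norm_nonneg _) (fun n => ?_) hb
  rw [Real.norm_eq_abs, strongDist, ← Real.sqrt_mul (by
    have := two_mul_pairing_le h (hσ n) hμ
    simp only [pairing] at this
    simp only [energy]
    linarith)]
  exact Real.abs_le_sqrt (sq_pairing_sub_le hκ h (hσ n) hμ hν)

theorem StrongTendstoSeq.tendsto_pairing_self (hκ : IsKernel κ) (h : EnergyPrinciple κ)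
    {σ : ℕ → Measure X} {μ : Measure X} (hσ : ∀ n, memEplus κ (σ n)) (hμ : memEplus κ μ)
    (hlim : StrongTendstoSeq κ σ μ) :
    Tendsto (fun n => pairing κ (σ n) (σ n)) atTop (𝓝 (pairing κ μ μ)) := by
  have h1 := hlim.tendsto_pairing hκ h hσ hμ hμ
  have h2 : Tendsto (fun n => strongDist κ (σ n) μ ^ 2) atTop (𝓝 0) := by
    simpa using Tendsto.pow hlim 2
  have h3 := (h2.add (h1.const_mul 2)).sub_const (pairing κ μ μ)
  have h4 : 0 + 2 * pairing κ μ μ - pairing κ μ μ = pairing κ μ μ := by ring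
  rw [h4] at h3
  refine h3.congr fun n => ?_
  rw [strongDist, Real.sq_sqrt]
  · simp only [pairing, energy]; ring
  · have := two_mul_pairing_le h (hσ n) hμ
    simp only [pairing] at this
    simp only [energy]
    linarith

theorem VagueTendstoSeq.measure_eq_zero_of_isOpen [LocallyCompactSpace X] {σ : ℕ → Measure X}
    {μ : Measure X} [μ.Regular] [∀ n, (σ n).Regular] (hlim : VagueTendstoSeq σ μ) {G : Set X}
    (hG : IsOpen G) (h0 : Tendsto (fun n => σ n G) atTop (𝓝 0)) : μ G = 0 := by
  rw [hG.measure_eq_iSup_isCompact, ENNReal.iSup_eq_zero]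
  refine fun K => ENNReal.iSup_eq_zero.2 fun hKG => ENNReal.iSup_eq_zero.2 fun hK => ?_
  obtain ⟨φ, hφK, hφG, hφc, hφ⟩ := exists_continuous_one_zero_of_isCompact hK hG.isClosed_compl
    (disjoint_compl_right_iff_subset.2 hKG)
  have hint : ∀ ρ : Measure X, ρ.Regular → Integrable φ ρ := fun ρ _ =>
    φ.continuous.integrable_of_hasCompactSupport hφc
  have hup : ∀ n, ENNReal.ofReal (∫ x, φ x ∂σ n) ≤ σ n G := fun n => by
    rw [ofReal_integral_eq_lintegral_ofReal (hint _ inferInstance)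
      (Eventually.of_forall fun x => (hφ x).1), ← lintegral_indicator_one hG.measurableSet]
    refine lintegral_mono fun x => ?_
    by_cases hx : x ∈ G
    · simpa [hx] using (hφ x).2
    · simp [hφG hx]
  have hlow : μ K ≤ ENNReal.ofReal (∫ x, φ x ∂μ) := by
    rw [ofReal_integral_eq_lintegral_ofReal (hint _ inferInstance)
      (Eventually.of_forall fun x => (hφ x).1), ← lintegral_indicator_one hK.measurableSet]
    refine lintegral_mono fun x => ?_
    by_cases hx : x ∈ K
    · simp [hx, hφK hx]
    · simp [hx]
  have hto := (ENNReal.continuous_ofReal.tendsto _).comp (hlim φ φ.continuous hφc)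
  exact le_antisymm (hlow.trans (le_of_tendsto_of_tendsto' hto h0 hup)) zero_le

end Equilibrium

section Capacitary

variable [BorelSpace X] [T2Space X] {κ : X → X → ℝ≥0∞} {A : Set X} {μ ν τ : Measure X}

omit [TopologicalSpace X] [BorelSpace X] [T2Space X] in
theorem potential_add (x : X) : potential κ (μ + ν) x = potential κ μ x + potential κ ν x :=
  lintegral_add_measure _ _ _

omit [TopologicalSpace X] [BorelSpace X] [T2Space X] in
theorem potential_smul (c : NNReal) (x : X) : potential κ (c • μ) x = c * potential κ μ x := by
  rw [potential, lintegral_smul_measure]; rfl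

theorem exists_minimizing_limit (hκ : IsKernel κ) (hperf : IsPerfect κ)
    (hclosed : StrongClosedEplusOn κ A) (hw : wcap κ A ≠ ⊤) :
    ∃ (σ : ℕ → Measure X) (μ : Measure X), (∀ n, memBreve κ A (σ n)) ∧ memEplus κ μ ∧
      Concentrated μ A ∧ StrongTendstoSeq κ σ μ ∧ pairing κ μ μ = (wcap κ A).toReal := by
  have h := hperf.1
  obtain ⟨σ, hσ, hlim⟩ := exists_minimizing_seq hw
  obtain ⟨μ, hμ, hσμ⟩ := hperf.2.1 σ (fun n => (hσ n).1)
    (strongCauchySeq_of_minimizing hκ h hσ hlim)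
  exact ⟨σ, μ, hσ, hμ, hclosed σ μ (fun n => ⟨(hσ n).1, (hσ n).2.1⟩) hμ hσμ, hσμ,
    tendsto_nhds_unique (hσμ.tendsto_pairing_self hκ h (fun n => (hσ n).1) hμ) hlim⟩

theorem wcap_toReal_le_pairing (hκ : IsKernel κ) (h : EnergyPrinciple κ) {σ : ℕ → Measure X}
    (hσ : ∀ n, memBreve κ A (σ n)) (hμ : memEplus κ μ) (hlim : StrongTendstoSeq κ σ μ)
    (hμw : pairing κ μ μ = (wcap κ A).toReal) (hτ : memBreve κ A τ) :
    (wcap κ A).toReal ≤ pairing κ μ τ := by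
  have hσ' := fun n => (hσ n).1
  set w := (wcap κ A).toReal
  have hquad : ∀ t : NNReal, w * (1 + t) ^ 2 ≤
      w + 2 * t * pairing κ μ τ + t ^ 2 * pairing κ τ τ := fun t => by
    rw [← hμw]
    refine ge_of_tendsto' (((hlim.tendsto_pairing_self hκ h hσ' hμ).add
      ((hlim.tendsto_pairing hκ h hσ' hμ hτ.1).const_mul (2 * (t : ℝ)))).add_const _) fun n => ?_
    rw [hμw]
    exact wcap_mul_sq_le hκ h (hσ n) hτ t
  have hlin : ∀ n : ℕ, 2 * w + 1 / ((n : ℝ) + 1) * w ≤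
      2 * pairing κ μ τ + 1 / ((n : ℝ) + 1) * pairing κ τ τ := fun n => by
    have hpos : 0 < 1 / ((n : ℝ) + 1) := by positivity
    have h1 := hquad (1 / ((n : ℝ) + 1)).toNNReal
    rw [Real.coe_toNNReal _ hpos.le] at h1
    refine le_of_mul_le_mul_left ?_ hpos
    linarith
  have ht := tendsto_one_div_add_atTop_nhds_zero_nat (𝕜 := ℝ)
  have := le_of_tendsto_of_tendsto' ((ht.mul_const w).const_add (2 * w))
    ((ht.mul_const (pairing κ τ τ)).const_add (2 * pairing κ μ τ)) hlin
  linarith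

theorem ae_wcap_le_potential (hκ : IsKernel κ) (h : EnergyPrinciple κ) (hw : wcap κ A ≠ ⊤)
    (hμ : memEplus κ μ) (hle : ∀ τ, memBreve κ A τ → (wcap κ A).toReal ≤ pairing κ μ τ)
    (hτ : memEplus κ τ) (hτA : Concentrated τ A) : ∀ᵐ x ∂τ, wcap κ A ≤ potential κ μ x := by
  have : μ.Regular := hμ.1
  have hm := measurable_potential hκ μ
  by_contra h0
  obtain ⟨σ, hσ, hσS⟩ := exists_memBreve_of_measure_ne_zero hκ h hτ hτA
    (measurableSet_le measurable_const hm).compl h0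
  have hlt : ∀ᵐ x ∂σ, potential κ μ x < wcap κ A := by
    rw [ae_iff]
    simpa only [not_lt, compl_compl] using hσS
  have hJ := h.mutualEnergy_lt_top hσ.1 hμ
  have hσ0 : σ ≠ 0 := by
    rintro rfl
    simpa using hσ.2.2
  have h1 := lintegral_strict_mono hσ0 aemeasurable_const
    ((lintegral_potential hκ h hσ.1 hμ).trans_ne hJ.ne) hlt
  rw [lintegral_potential hκ h hσ.1 hμ, lintegral_const, hσ.2.2, mul_one] at h1
  refine h1.not_ge ?_
  rw [← ENNReal.toReal_le_toReal hw hJ.ne]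
  exact (hle σ hσ).trans_eq (pairing_comm hκ h hμ hσ.1)

theorem measure_wcap_add_lt_potential [LocallyCompactSpace X] (hκ : IsKernel κ)
    (hperf : IsPerfect κ) (hw : wcap κ A ≠ ⊤) {σ : ℕ → Measure X}
    (hσ : ∀ n, memBreve κ A (σ n)) (hμ : memEplus κ μ) (hlim : StrongTendstoSeq κ σ μ)
    (hμw : pairing κ μ μ = (wcap κ A).toReal)
    (hle : ∀ n, ∀ᵐ x ∂σ n, wcap κ A ≤ potential κ μ x) {ε : ℝ≥0∞} (hε : ε ≠ 0) (hε' : ε ≠ ⊤) :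
    μ {x | wcap κ A + ε < potential κ μ x} = 0 := by
  have h := hperf.1
  have hσ' := fun n => (hσ n).1
  have : μ.Regular := hμ.1
  have : ∀ n, (σ n).Regular := fun n => (hσ n).1.1
  have hG : IsOpen {x | wcap κ A + ε < potential κ μ x} :=
    (lowerSemicontinuous_potential hκ μ).isOpen_preimage _
  set G := {x | wcap κ A + ε < potential κ μ x}
  have hJ : Tendsto (fun n => mutualEnergy κ (σ n) μ) atTop (𝓝 (wcap κ A)) := by
    rw [← ENNReal.tendsto_toReal_iff (fun n => (h.mutualEnergy_lt_top (hσ' n) hμ).ne) hw, ← hμw]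
    exact hlim.tendsto_pairing hκ h hσ' hμ hμ
  have hb : ∀ n, σ n G ≤ (mutualEnergy κ (σ n) μ - wcap κ A) / ε := fun n => by
    rw [ENNReal.le_div_iff_mul_le (Or.inl hε) (Or.inl hε')]
    refine ENNReal.le_sub_of_add_le_left hw ?_
    rw [← lintegral_potential hκ h (hσ' n) hμ]
    calc wcap κ A + σ n G * ε = ∫⁻ x, wcap κ A + G.indicator (fun _ => ε) x ∂σ n := by
          rw [lintegral_add_left measurable_const, lintegral_const, (hσ n).2.2, mul_one,
            lintegral_indicator_const hG.measurableSet, mul_comm]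
      _ ≤ _ := by
          refine lintegral_mono_ae ((hle n).mono fun x hx => ?_)
          by_cases hxG : x ∈ G
          · rw [indicator_of_mem hxG]; exact le_of_lt hxG
          · rwa [indicator_of_notMem hxG, add_zero]
  refine (hperf.2.2 σ μ hσ' hμ hlim).measure_eq_zero_of_isOpen hG ?_
  refine tendsto_of_tendsto_of_tendsto_of_le_of_le tendsto_const_nhds ?_ (fun _ => zero_le) hb
  have h1 := ENNReal.Tendsto.div_const (ENNReal.Tendsto.sub hJ
    (tendsto_const_nhds (x := wcap κ A)) (Or.inl hw)) (b := ε) (Or.inr hε)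
  rwa [tsub_self, ENNReal.zero_div] at h1

theorem exists_capacitary [LocallyCompactSpace X] (hκ : IsKernel κ) (hperf : IsPerfect κ)
    (hfr : FrostmanMax κ) (hclosed : StrongClosedEplusOn κ A) (hw : wcap κ A ≠ ⊤)
    (hw0 : wcap κ A ≠ 0) :
    ∃ γ, memEplus κ γ ∧ Concentrated γ A ∧ γ univ = innerCap κ A ∧
      (∀ τ, memEplus κ τ → Concentrated τ A → ∀ᵐ x ∂τ, potential κ γ x = 1) ∧
      ∀ x, potential κ γ x ≤ 1 := by
  have h := hperf.1
  obtain ⟨σ, μ, hσ, hμ, hμA, hlim, hμw⟩ := exists_minimizing_limit hκ hperf hclosed hw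
  have : μ.Regular := hμ.1
  have hlow := fun τ => ae_wcap_le_potential (τ := τ) hκ h hw hμ
    fun τ hτ => wcap_toReal_le_pairing hκ h hσ hμ hlim hμw hτ
  have hup : ∀ᵐ x ∂μ, potential κ μ x ≤ wcap κ A := by
    have hn : ∀ n : ℕ, ∀ᵐ x ∂μ, potential κ μ x ≤ wcap κ A + ((n : ℝ≥0∞) + 1)⁻¹ := fun n => by
      rw [ae_iff]
      simp only [not_le]
      exact measure_wcap_add_lt_potential hκ hperf hw hσ hμ hlim hμw
        (fun n => hlow _ (hσ n).1 (hσ n).2.1) (by simp) (by simp)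
    filter_upwards [ae_all_iff.2 hn] with x hx
    have ht : Tendsto (fun n : ℕ => wcap κ A + ((n : ℝ≥0∞) + 1)⁻¹) atTop (𝓝 (wcap κ A + 0)) := by
      have := ((tendsto_add_atTop_iff_nat 1).2 ENNReal.tendsto_inv_nat_nhds_zero).const_add
        (wcap κ A)
      simpa using this
    rw [add_zero] at ht
    exact ge_of_tendsto' ht hx
  have hmass : μ univ = 1 := by
    have h1 : mutualEnergy κ μ μ = wcap κ A * μ univ := by
      rw [← lintegral_potential hκ h hμ hμ, ← lintegral_const]
      refine lintegral_congr_ae ?_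
      filter_upwards [hup, hlow μ hμ hμA] with x h1 h2 using le_antisymm h1 h2
    have h2 : mutualEnergy κ μ μ = wcap κ A :=
      (ENNReal.toReal_eq_toReal_iff' hμ.2.ne hw).1 hμw
    rw [h2] at h1
    exact ((ENNReal.mul_right_inj hw0 hw).1 ((mul_one _).trans h1)).symm
  set c : NNReal := (wcap κ A).toNNReal⁻¹
  have hc : (c : ℝ≥0∞) = (wcap κ A)⁻¹ := by
    rw [ENNReal.coe_inv (ENNReal.toNNReal_ne_zero.2 ⟨hw0, hw⟩), ENNReal.coe_toNNReal hw]
  have hcw : (c : ℝ≥0∞) * wcap κ A = 1 := by rw [hc, ENNReal.inv_mul_cancel hw0 hw]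
  have hγ := hμ.smul hκ h c
  have hle : ∀ s, μ s = 0 → (c • μ) s = 0 := fun s hs => by
    rw [Measure.smul_apply, hs, smul_zero]
  have hle1 : ∀ x, potential κ (c • μ) x ≤ 1 := by
    refine hfr _ hγ fun x hx => not_lt.1 fun hlt => ?_
    have : (c • μ).Regular := hγ.1
    have hopen : IsOpen {x | 1 < potential κ (c • μ) x} :=
      (lowerSemicontinuous_potential hκ _).isOpen_preimage _
    refine (hx _ hopen hlt).ne' (hle _ ?_)
    refine measure_mono_null (fun y hy => ?_) (ae_iff.1 hup)
    rw [mem_ofPred_eq, potential_smul, ← hcw] at hy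
    exact fun hy' => hy.not_ge (by gcongr)
  refine ⟨c • μ, hγ, fun K hK => hle _ (hμA K hK), ?_, fun τ hτ hτA => ?_, hle1⟩
  · rw [Measure.smul_apply, hmass, innerCap, ← hc]
    exact mul_one _
  · filter_upwards [hlow τ hτ hτA] with x hx
    refine le_antisymm (hle1 x) ?_
    rw [potential_smul, ← hcw]
    gcongr

end Capacitary

section GaussProblem

variable [BorelSpace X] [T2Space X] {κ : X → X → ℝ≥0∞} {A : Set X} {ζ β μ ν τ : Measure X}
  {f : X → EReal} {η : ℝ≥0∞}

omit [TopologicalSpace X] [BorelSpace X] [T2Space X] in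
theorem wPotential_eq_coe_iff (hf : ∀ x, f x = -((potential κ ζ x : ℝ≥0∞) : EReal)) (hη : η ≠ ⊤)
    (x : X) : wPotential κ f μ x = (η : EReal) ↔
      potential κ ζ x < ⊤ ∧ potential κ μ x = potential κ ζ x + η := by
  rw [wPotential, hf]
  induction potential κ ζ x with
  | top => simpa using (EReal.coe_ennreal_ne_bot η).symm
  | coe z =>
    lift η to NNReal using hη
    induction potential κ μ x with
    | top => simpa [← ENNReal.coe_add] using (EReal.coe_nnreal_ne_top η).symm
    | coe u =>
      simp only [ENNReal.coe_lt_top, true_and, ← ENNReal.coe_add, ENNReal.coe_inj]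
      rw [← NNReal.coe_inj, NNReal.coe_add]
      simp only [EReal.coe_nnreal_eq_coe_real]
      norm_cast
      rw [← sub_eq_add_neg, sub_eq_iff_eq_add, add_comm (η : ℝ)]
      norm_cast

theorem field_integral_neg_potential (hκ : IsKernel κ) (h : EnergyPrinciple κ)
    (hf : ∀ x, f x = -((potential κ ζ x : ℝ≥0∞) : EReal)) (hζ : memEplus κ ζ)
    (hτ : memEplus κ τ) : FieldIntegrable f τ ∧ fieldIntegral f τ = -pairing κ τ ζ := by
  have : ζ.Regular := hζ.1
  have hm := (measurable_potential hκ ζ).aemeasurable (μ := τ)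
  have hlt := hτ.ae_potential_lt_top hκ h hζ
  have hreal : (fun x => (f x).toReal) = fun x => -(potential κ ζ x).toReal := by
    funext x
    rw [hf, EReal.toReal_neg_eq, EReal.toReal_coe_ennreal]
  refine ⟨⟨?_, ?_⟩, ?_⟩
  · rw [hreal]
    refine (integrable_toReal_of_lintegral_ne_top hm ?_).neg
    rw [lintegral_potential hκ h hτ hζ]
    exact (h.mutualEnergy_lt_top hτ hζ).ne
  · filter_upwards [hlt] with x hx
    rw [hf]
    simp [hx.ne]
  · rw [fieldIntegral, hreal, integral_neg, integral_toReal hm hlt,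
      lintegral_potential hκ h hτ hζ, pairing]

theorem IsSolution.pairing_le (hκ : IsKernel κ) (h : EnergyPrinciple κ)
    (hf : ∀ x, f x = -((potential κ ζ x : ℝ≥0∞) : EReal)) (hζ : memEplus κ ζ)
    (hμ : IsSolution κ A f μ) (hτ : memBreve κ A τ) :
    pairing κ μ μ - 2 * pairing κ μ ζ ≤ pairing κ τ τ - 2 * pairing κ τ ζ := by
  have hfτ := field_integral_neg_potential hκ h hf hζ hτ.1
  have hfμ := field_integral_neg_potential hκ h hf hζ hμ.1.1.1
  have hle : ((gaussI κ f μ : ℝ) : EReal) ≤ gaussI κ f τ :=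
    hμ.2.trans_le (iInf₂_le τ ⟨hτ, hfτ.1⟩)
  rw [EReal.coe_le_coe_iff, gaussI, gaussI, hfτ.2, hfμ.2] at hle
  simp only [pairing, energy] at hle ⊢
  linarith

theorem pairing_eq_of_ae (hκ : IsKernel κ) (h : EnergyPrinciple κ) (hζ : memEplus κ ζ)
    (hμ : memEplus κ μ) (hτ : memEplus κ τ) (hη : η ≠ ⊤) (hτ1 : τ univ = 1)
    (hae : ∀ᵐ x ∂τ, potential κ μ x = potential κ ζ x + η) :
    pairing κ τ μ = pairing κ τ ζ + η.toReal := by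
  rw [pairing, pairing, ← ENNReal.toReal_add (h.mutualEnergy_lt_top hτ hζ).ne hη,
    ← lintegral_potential hκ h hτ hμ, lintegral_congr_ae hae,
    lintegral_add_right _ measurable_const, lintegral_const, hτ1, mul_one,
    lintegral_potential hκ h hτ hζ]

theorem IsSolution.eq_of_ae (hκ : IsKernel κ) (h : EnergyPrinciple κ)
    (hf : ∀ x, f x = -((potential κ ζ x : ℝ≥0∞) : EReal)) (hζ : memEplus κ ζ)
    (hμ : IsSolution κ A f μ) (hν : memBreve κ A ν) (hη : η ≠ ⊤)
    (hae : ∀ τ, memEplus κ τ → Concentrated τ A →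
      ∀ᵐ x ∂τ, potential κ ν x = potential κ ζ x + η) : μ = ν := by
  refine eq_of_le_two_mul_pairing h hμ.1.1.1 hν.1 ?_
  have h1 := hμ.pairing_le hκ h hf hζ hν
  have h2 := pairing_eq_of_ae hκ h hζ hν.1 hμ.1.1.1 hη hμ.1.1.2.2 (hae _ hμ.1.1.1 hμ.1.1.2.1)
  have h3 := pairing_eq_of_ae hκ h hζ hν.1 hν.1 hη hν.2.2 (hae _ hν.1 hν.2.1)
  linarith

theorem eq_of_ae_potential_eq (hκ : IsKernel κ) (h : EnergyPrinciple κ) (hμ : memEplus κ μ)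
    (hν : memEplus κ ν) (h1 : ∀ᵐ x ∂μ, potential κ μ x = potential κ ν x)
    (h2 : ∀ᵐ x ∂ν, potential κ μ x = potential κ ν x) : μ = ν := by
  refine eq_of_le_two_mul_pairing h hμ hν (le_of_eq ?_)
  have e1 : pairing κ μ μ = pairing κ μ ν := by
    rw [pairing, pairing, ← lintegral_potential hκ h hμ hμ, lintegral_congr_ae h1,
      lintegral_potential hκ h hμ hν]
  have e2 : pairing κ ν μ = pairing κ ν ν := by
    rw [pairing, pairing, ← lintegral_potential hκ h hν hμ, lintegral_congr_ae h2,
      lintegral_potential hκ h hν hν]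
  rw [e1, ← e2, pairing_comm hκ h hν hμ]
  ring

theorem ae_potential_balayage (hκ : IsKernel κ) (h : EnergyPrinciple κ) (hζ : memEplus κ ζ)
    (hβ : IsInnerBalayage κ A ζ β) (hτ : memEplus κ τ) (hτA : Concentrated τ A) :
    ∀ᵐ x ∂τ, potential κ β x = potential κ ζ x := by
  have : ζ.Regular := hζ.1
  have : β.Regular := hβ.1.1
  exact hβ.2.2.ae hκ h
    (measurableSet_eq_fun (measurable_potential hκ β) (measurable_potential hκ ζ)) hτ hτA

theorem balayage_univ_le (hκ : IsKernel κ) (h : EnergyPrinciple κ) (hζ : memEplus κ ζ)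
    (hβ : IsInnerBalayage κ A ζ β) {γ : Measure X} (hγ : memEplus κ γ) (hγA : Concentrated γ A)
    (hγ1 : ∀ τ, memEplus κ τ → Concentrated τ A → ∀ᵐ x ∂τ, potential κ γ x = 1)
    (hγle : ∀ x, potential κ γ x ≤ 1) : β univ ≤ ζ univ := by
  have := hγ.sigmaFinite hκ h
  have := hζ.sigmaFinite hκ h
  have := hβ.1.sigmaFinite hκ h
  calc β univ = ∫⁻ x, potential κ γ x ∂β := by
        rw [lintegral_congr_ae (hγ1 β hβ.1 hβ.2.1), lintegral_one]
    _ = ∫⁻ x, potential κ β x ∂γ := by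
        rw [lintegral_potential hκ h hβ.1 hγ, mutualEnergy_comm hκ,
          lintegral_potential hκ h hγ hβ.1]
    _ = ∫⁻ x, potential κ γ x ∂ζ := by
        rw [lintegral_congr_ae (ae_potential_balayage hκ h hζ hβ hγ hγA),
          lintegral_potential hκ h hγ hζ, mutualEnergy_comm hκ, lintegral_potential hκ h hζ hγ]
    _ ≤ ∫⁻ _, 1 ∂ζ := lintegral_mono hγle
    _ = ζ univ := lintegral_one

theorem exists_memBreve_potential_eq [LocallyCompactSpace X] (hκ : IsKernel κ)
    (hperf : IsPerfect κ) (hfr : FrostmanMax κ) (hcap0 : innerCap κ A ≠ 0)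
    (hclosed : StrongClosedEplusOn κ A) (hζ : memEplus κ ζ) (hζ1 : ζ univ ≤ 1)
    (hβ : IsInnerBalayage κ A ζ β) (hex : innerCap κ A ≠ ⊤ ∨ β univ = 1) :
    ∃ ν, memBreve κ A ν ∧ ∀ τ, memEplus κ τ → Concentrated τ A →
      ∀ᵐ x ∂τ, potential κ ν x = potential κ ζ x + (1 - β univ) / innerCap κ A := by
  have h := hperf.1
  by_cases hβ1 : β univ = 1
  · refine ⟨β, ⟨hβ.1, hβ.2.1, hβ1⟩, fun τ hτ hτA => ?_⟩
    simpa only [hβ1, tsub_self, ENNReal.zero_div, add_zero] using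
      ae_potential_balayage hκ h hζ hβ hτ hτA
  · have hcap := hex.resolve_right hβ1
    obtain ⟨γ, hγ, hγA, hγcap, hγ1, hγle⟩ := exists_capacitary hκ hperf hfr hclosed
      (fun hw => hcap0 (ENNReal.inv_eq_zero.2 hw)) (fun hw => hcap (ENNReal.inv_eq_top.2 hw))
    have hβle := (balayage_univ_le hκ h hζ hβ hγ hγA hγ1 hγle).trans hζ1
    have hη : (1 - β univ) / innerCap κ A ≠ ⊤ :=
      ENNReal.div_ne_top (ENNReal.sub_ne_top ENNReal.one_ne_top) hcap0
    set η := (1 - β univ) / innerCap κ A with hηdef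
    have hηγ := hγ.smul hκ h η.toNNReal
    refine ⟨β + η.toNNReal • γ, ⟨hβ.1.add hκ h hηγ, fun K hK => ?_, ?_⟩, fun τ hτ hτA => ?_⟩
    · rw [Measure.add_apply, Measure.smul_apply, hβ.2.1 K hK, hγA K hK, smul_zero, add_zero]
    · rw [Measure.add_apply, Measure.smul_apply, ENNReal.smul_def, ENNReal.coe_toNNReal hη,
        smul_eq_mul, hγcap, hηdef, ENNReal.div_mul_cancel hcap0 hcap,
        add_tsub_cancel_of_le hβle]
    · filter_upwards [ae_potential_balayage hκ h hζ hβ hτ hτA, hγ1 τ hτ hτA] with x hx hx1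
      rw [potential_add, potential_smul, hx, hx1, mul_one, ENNReal.coe_toNNReal hη]

end GaussProblem

theorem stmt7 {X : Type*} [TopologicalSpace X] [T2Space X] [LocallyCompactSpace X]
    [MeasurableSpace X] [BorelSpace X]
    (κ : X → X → ℝ≥0∞) (A : Set X) (ζ β : Measure X) (f : X → EReal)
    (hker : IsKernel κ) (hperf : IsPerfect κ)
    (hfr : FrostmanMax κ) (hdom : DominationPrinciple κ)
    (hcap0 : innerCap κ A ≠ 0) (hclosed : StrongClosedEplusOn κ A)
    (hζ : memEplus κ ζ) (hζ1 : ζ Set.univ ≤ 1)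
    (hf : ∀ x, f x = -((potential κ ζ x : ℝ≥0∞) : EReal))
    (hβ : IsInnerBalayage κ A ζ β)
    (hex : innerCap κ A ≠ ⊤ ∨ β Set.univ = 1)
    (l : Measure X) (hl : IsSolution κ A f l) :
    -- `l ∈ E⁺(A)` and `U_f^l = η` n.e. on `A`
    (memEplus κ l ∧ Concentrated l A ∧
      NearlyEverywhere κ A
        (fun x => wPotential κ f l x
          = ((((1 : ℝ≥0∞) - β Set.univ) / innerCap κ A : ℝ≥0∞) : EReal))) ∧
    -- and `l` is the unique such measure in `E⁺(A)`
    ∀ μ : Measure X, memEplus κ μ → Concentrated μ A →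
      NearlyEverywhere κ A
        (fun x => wPotential κ f μ x
          = ((((1 : ℝ≥0∞) - β Set.univ) / innerCap κ A : ℝ≥0∞) : EReal)) →
      μ = l := by
  have h := hperf.1
  have hη : ((1 : ℝ≥0∞) - β Set.univ) / innerCap κ A ≠ ⊤ :=
    ENNReal.div_ne_top (ENNReal.sub_ne_top ENNReal.one_ne_top) hcap0
  obtain ⟨ν, hν, hae⟩ :=
    exists_memBreve_potential_eq hker hperf hfr hcap0 hclosed hζ hζ1 hβ hex
  obtain rfl := hl.eq_of_ae hker h hf hζ hν hη hae
  simp only [wPotential_eq_coe_iff hf hη]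
  refine ⟨⟨hν.1, hν.2.1, nearlyEverywhere_of_forall_ae hker h fun τ hτ hτA => ?_⟩,
    fun μ hμ hμA hne => ?_⟩
  · filter_upwards [hτ.ae_potential_lt_top hker h hζ, hae τ hτ hτA] with x h1 h2 using ⟨h1, h2⟩
  · have : ζ.Regular := hζ.1
    have : μ.Regular := hμ.1
    have hmeas := (measurableSet_lt (measurable_potential hker ζ)
      (measurable_const (a := (⊤ : ℝ≥0∞)))).inter
      (measurableSet_eq_fun (measurable_potential hker μ)
        ((measurable_potential hker ζ).add_const
          (((1 : ℝ≥0∞) - β Set.univ) / innerCap κ A)))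
    have hμae := fun τ => hne.ae (τ := τ) hker h hmeas
    refine eq_of_ae_potential_eq hker h hμ hν.1 ?_ ?_
    · filter_upwards [hμae _ hμ hμA, hae _ hμ hμA] with x h1 h2 using h1.2.trans h2.symm
    · filter_upwards [hμae _ hν.1 hν.2.1, hae _ hν.1 hν.2.1] with x h1 h2 using h1.2.trans h2.symm

end GaussVar
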